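/- Let c(t) = P₀(1-t)² + P₁·2t(1-t) + P₂t² be a quadratic Bézier curve in R^3 (or R^2 with scalar cross product). Then c(t) × c'(t) = 2(P₀ × P₁)(1-t)² + (P₀ × P₂)·2t(1-t) + 2(P₁ × P₂)t², i.e., the cross product of the quadratic curve with its derivative is a quadratic (not cubic) Bézier expression in the pairwise cross products of the control points. -/

import Mathlib

open RealInnerProductSpace

noncomputable def cross3 (a b : EuclideanSpace ℝ (Fin 3)) : EuclideanSpace ℝ (Fin 3) :=
  (WithLp.equiv 2 (Fin 3 → ℝ)).symm
    ![a 1 * b 2 - a 2 * b 1, a 2 * b 0 - a 0 * b 2, a 0 * b 1 - a 1 * b 0]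

theorem stmt3 (P0 P1 P2 : EuclideanSpace ℝ (Fin 3))
    (c : ℝ → EuclideanSpace ℝ (Fin 3))
    (hc : ∀ t, c t = (1 - t) ^ 2 • P0 + (2 * t * (1 - t)) • P1 + t ^ 2 • P2) :
    ∀ t : ℝ,
      cross3 (c t) (deriv c t) =
        (2 * (1 - t) ^ 2) • cross3 P0 P1 + (2 * t * (1 - t)) • cross3 P0 P2 +
          (2 * t ^ 2) • cross3 P1 P2 := by
  intro t
  have hd : HasDerivAt c ((-2 * (1 - t)) • P0 + (2 - 4 * t) • P1 + (2 * t) • P2) t := by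
    have hcf : c = fun t => (1 - t) ^ 2 • P0 + (2 * t * (1 - t)) • P1 + t ^ 2 • P2 := funext hc
    rw [hcf]
    have h1 : HasDerivAt (fun t : ℝ => 1 - t) (-1) t := (hasDerivAt_id t).const_sub 1
    have h2 : HasDerivAt (fun t : ℝ => (1 - t) ^ 2) (-2 * (1 - t)) t := by
      refine (h1.pow 2).congr_deriv ?_
      norm_num
    have h3 : HasDerivAt (fun t : ℝ => 2 * t * (1 - t)) (2 - 4 * t) t := by
      refine (((hasDerivAt_id t).const_mul 2).mul h1).congr_deriv ?_
      simp only [id]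
      ring
    have h4 : HasDerivAt (fun t : ℝ => t ^ 2) (2 * t) t := by
      refine ((hasDerivAt_id t).pow 2).congr_deriv ?_
      simp
    exact ((h2.smul_const P0).add (h3.smul_const P1)).add (h4.smul_const P2)
  rw [hd.deriv, hc t]
  ext i
  fin_cases i <;> simp [cross3] <;> ring
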